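/- For every n ≥ 2: (a) writing Σ_{σ ∈ S_n} x^{exc(σ)} 2^{cyc(σ)−fix(σ)} = Σ_{k=0}^{n−1} u_k x^k, the coefficient sequence is alternatingly increasing: u_0 ≤ u_{n−1} ≤ u_1 ≤ u_{n−2} ≤ ⋯ ≤ u_{⌊n/2⌋}; and (b) writing Σ_{σ ∈ S_n} x^{exc(σ)} 2^{cyc(σ)} = Σ_{k=0}^{n−1} c_k x^k, the coefficient sequence is spiral: c_{n−1} ≤ c_0 ≤ c_{n−2} ≤ c_1 ≤ ⋯ ≤ c_{⌊(n−1)/2⌋}. -/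

import Mathlib

open Finset

namespace SucEuler

/-- One-line notation word of a permutation: `word π i` is the value (in `1..n`)
at position `i ∈ {1,…,n}`, and `0` for positions outside `{1,…,n}`
(this implements the conventions `π(0)=π(n+1)=0`). -/
def word {n : ℕ} (π : Equiv.Perm (Fin n)) (i : ℕ) : ℕ :=
  if h : 1 ≤ i ∧ i ≤ n then ((π ⟨i - 1, by omega⟩ : Fin n) : ℕ) + 1 else 0

/-- number of descents -/
def des {n : ℕ} (π : Equiv.Perm (Fin n)) : ℕ :=
  ((Finset.Icc 1 (n - 1)).filter fun i => word π (i + 1) < word π i).card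

/-- number of ascents -/
def asc {n : ℕ} (π : Equiv.Perm (Fin n)) : ℕ :=
  ((Finset.Icc 1 (n - 1)).filter fun i => word π i < word π (i + 1)).card

/-- number of successions -/
def suc {n : ℕ} (π : Equiv.Perm (Fin n)) : ℕ :=
  ((Finset.Icc 1 (n - 1)).filter fun i => word π (i + 1) = word π i + 1).card

/-- number of big ascents -/
def basc {n : ℕ} (π : Equiv.Perm (Fin n)) : ℕ :=
  ((Finset.Icc 1 (n - 1)).filter fun i => word π i + 2 ≤ word π (i + 1)).card

/-- number of excedances -/
def excStat {n : ℕ} (σ : Equiv.Perm (Fin n)) : ℕ :=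
  (Finset.univ.filter fun i : Fin n => i < σ i).card

/-- number of fixed points -/
def fixStat {n : ℕ} (σ : Equiv.Perm (Fin n)) : ℕ :=
  (Finset.univ.filter fun i : Fin n => σ i = i).card

/-- number of drops -/
def dropStat {n : ℕ} (σ : Equiv.Perm (Fin n)) : ℕ :=
  (Finset.univ.filter fun i : Fin n => σ i < i).card

/-- number of excedances at positions `i ≥ 2` -/
def excHat {n : ℕ} (σ : Equiv.Perm (Fin n)) : ℕ :=
  (Finset.univ.filter fun i : Fin n => 0 < (i : ℕ) ∧ i < σ i).card

/-- number of fixed points other than `1` -/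
def fixHat {n : ℕ} (σ : Equiv.Perm (Fin n)) : ℕ :=
  (Finset.univ.filter fun i : Fin n => 0 < (i : ℕ) ∧ σ i = i).card

/-- number of cycles (orbits) of a permutation -/
def cyc {n : ℕ} (σ : Equiv.Perm (Fin n)) : ℕ :=
  σ.cycleType.card + fixStat σ

/-- number of cycle double ascents: values `x` with `σ⁻¹(x) < x < σ(x)` -/
def cda {n : ℕ} (σ : Equiv.Perm (Fin n)) : ℕ :=
  (Finset.univ.filter fun x : Fin n => σ⁻¹ x < x ∧ x < σ x).card

open Classical in
/-- number of left-to-right minima -/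
noncomputable def lrmin {n : ℕ} (π : Equiv.Perm (Fin n)) : ℕ :=
  ((Finset.Icc 1 n).filter fun i => ∀ j ∈ Finset.Icc 1 n, j < i → word π i < word π j).card

open Classical in
/-- number of proper left-to-right minima -/
noncomputable def plrmin {n : ℕ} (π : Equiv.Perm (Fin n)) : ℕ :=
  ((Finset.Icc 1 n).filter fun i =>
    (∀ j ∈ Finset.Icc 1 n, j < i → word π i < word π j) ∧ word π i ≠ 1 ∧
      ∃ k ∈ Finset.Icc 1 n, i < k ∧ word π k = word π i - 1 ∧ word π (k + 1) < word π k).card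

open Classical in
/-- number of simsun successions -/
noncomputable def simsuc {n : ℕ} (π : Equiv.Perm (Fin n)) : ℕ :=
  ((Finset.Icc 1 n).filter fun i =>
    ∃ j ∈ Finset.Icc 1 n, i < j ∧ word π j = word π i + 1 ∧
      ∀ k ∈ Finset.Icc 1 n, i < k → k < j → word π i + 1 < word π k).card

/-- number of peaks (with the boundary conventions `π(0)=π(n+1)=0`) -/
def pk {n : ℕ} (π : Equiv.Perm (Fin n)) : ℕ :=
  ((Finset.Icc 1 n).filter fun i => word π (i - 1) < word π i ∧ word π (i + 1) < word π i).card

/-- number of valleys -/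
def valStat {n : ℕ} (π : Equiv.Perm (Fin n)) : ℕ :=
  ((Finset.Icc 1 n).filter fun i => word π i < word π (i - 1) ∧ word π i < word π (i + 1)).card

/-- number of double ascents -/
def dasc {n : ℕ} (π : Equiv.Perm (Fin n)) : ℕ :=
  ((Finset.Icc 1 n).filter fun i => word π (i - 1) < word π i ∧ word π i < word π (i + 1)).card

/-- number of double descents -/
def ddes {n : ℕ} (π : Equiv.Perm (Fin n)) : ℕ :=
  ((Finset.Icc 1 n).filter fun i => word π (i + 1) < word π i ∧ word π i < word π (i - 1)).card

open Classical in
/-- `nextVal σ m x` is the (0-indexed) first value `≤ m` (i.e. `< m` in 0-indexed terms)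
in the forward orbit of `x` under `σ`: it equals `σ^t(x)` for the minimal `t ≥ 1`
with `σ^t(x) < m`, when such `t` exists. This is the action of the permutation `σ_k`
(with `m = n - k`) obtained by removing the `k` largest letters from the cycles of `σ`. -/
noncomputable def nextVal {n : ℕ} (σ : Equiv.Perm (Fin n)) (m : ℕ) (x : Fin n) : ℕ :=
  if h : ∃ t : ℕ, 0 < t ∧ (((σ ^ t) x : Fin n) : ℕ) < m then (((σ ^ Nat.find h) x : Fin n) : ℕ)
  else 0

/-- `σ` is a simsun permutation of the second kind: for every `0 ≤ k ≤ n-1`, the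
permutation of `[n-k]` obtained from `σ` by removing the `k` largest letters has
no cycle double ascents. (Here `m = n - k` and values are 0-indexed.) -/
def IsSimsun2 {n : ℕ} (σ : Equiv.Perm (Fin n)) : Prop :=
  ∀ m ≤ n, ∀ x : Fin n, (x : ℕ) < m →
    ¬ (nextVal σ⁻¹ m x < (x : ℕ) ∧ (x : ℕ) < nextVal σ m x)

noncomputable instance {n : ℕ} : DecidablePred (IsSimsun2 (n := n)) :=
  fun _ => Classical.propDecidable _

/-- the derangement polynomial `d_n(x)` -/
def dpoly (n : ℕ) (x : ℝ) : ℝ :=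
  ∑ σ ∈ Finset.univ.filter fun σ : Equiv.Perm (Fin n) => fixStat σ = 0, x ^ excStat σ

/-- the Eulerian polynomial `A_n(x)` -/
def eulerian (n : ℕ) (x : ℝ) : ℝ :=
  ∑ π : Equiv.Perm (Fin n), x ^ des π


/-- `u_k = Σ_{σ ∈ S_n, exc σ = k} 2^(cyc σ - fix σ)`, the coefficient of `x^k` in
`Σ_{σ ∈ S_n} x^exc 2^(cyc-fix)` -/
def uCoeff (n k : ℕ) : ℝ :=
  ∑ σ ∈ Finset.univ.filter fun σ : Equiv.Perm (Fin n) => excStat σ = k,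
    (2 : ℝ) ^ (cyc σ - fixStat σ)

/-- `c_k = Σ_{σ ∈ S_n, exc σ = k} 2^(cyc σ)`, the coefficient of `x^k` in
`Σ_{σ ∈ S_n} x^exc 2^cyc` -/
def cCoeff (n k : ℕ) : ℝ :=
  ∑ σ ∈ Finset.univ.filter fun σ : Equiv.Perm (Fin n) => excStat σ = k, (2 : ℝ) ^ cyc σ

/-- derangement numbers by excedances, by recurrence -/
noncomputable def dN : ℕ → ℤ → ℝ
  | 0, k => if k = 0 then 1 else 0
  | 1, _ => 0
  | (n + 2), k => k * dN (n + 1) k + (n + 2 - k) * dN (n + 1) (k - 1) + (n + 1) * dN n (k - 1)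

/-- Eulerian numbers, by recurrence -/
noncomputable def aN : ℕ → ℤ → ℝ
  | 0, k => if k = 0 then 1 else 0
  | (n + 1), k => (k + 1) * aN n k + (n + 1 - k) * aN n (k - 1)

lemma dN_succ (n : ℕ) (k : ℤ) : dN (n + 2) k =
    k * dN (n + 1) k + (n + 2 - k) * dN (n + 1) (k - 1) + (n + 1) * dN n (k - 1) := by
  rw [dN]

lemma aN_succ (n : ℕ) (k : ℤ) :
    aN (n + 1) k = (k + 1) * aN n k + (n + 1 - k) * aN n (k - 1) := by
  rw [aN]

lemma dN_neg : ∀ (n : ℕ) (k : ℤ), k < 0 → dN n k = 0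
  | 0, k, h => by simp [dN, h.ne]
  | 1, k, h => by simp [dN]
  | (n + 2), k, h => by
    rw [dN, dN_neg (n + 1) k h, dN_neg (n + 1) (k - 1) (by omega), dN_neg n (k - 1) (by omega)]
    simp

lemma aN_neg : ∀ (n : ℕ) (k : ℤ), k < 0 → aN n k = 0
  | 0, k, h => by simp [aN, h.ne]
  | (n + 1), k, h => by
    rw [aN, aN_neg n k h, aN_neg n (k - 1) (by omega)]
    simp

lemma dN_symm : ∀ (n : ℕ) (k l : ℤ), k + l = n → dN n k = dN n l
  | 0, k, l, h => by
    have : k = 0 ↔ l = 0 := by constructor <;> intro h' <;> simp at h <;> omega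
    simp [dN, this]
  | 1, k, l, h => by simp [dN]
  | (n + 2), k, l, h => by
    have e1 := dN_symm (n + 1) k (l - 1) (by push_cast at h ⊢; omega)
    have e2 := dN_symm (n + 1) (k - 1) l (by push_cast at h ⊢; omega)
    have e3 := dN_symm n (k - 1) (l - 1) (by push_cast at h ⊢; omega)
    have hr : (k : ℝ) + l = n + 2 := by exact_mod_cast h
    rw [dN, dN, e1, e2, e3]
    have : (k : ℝ) = n + 2 - l := by linarith
    rw [this]; ring

lemma aN_symm : ∀ (n : ℕ) (k l : ℤ), k + l = n → aN (n + 1) k = aN (n + 1) l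
  | 0, k, l, h => by
    have h' : l = -k := by simp at h; omega
    subst h'
    simp only [aN]
    by_cases h0 : k = 0
    · simp [h0]
    by_cases h1 : k = 1
    · simp [h1]
    by_cases h2 : k = -1
    · simp [h2]
    have e1 : ¬ (k - 1 = 0) := by omega
    have e2 : ¬ (-k - 1 = 0) := by omega
    have e3 : ¬ (-k = 0) := by omega
    rw [if_neg h0, if_neg e1, if_neg e2, if_neg e3]; simp
  | (n + 1), k, l, h => by
    have e1 := aN_symm n k (l - 1) (by push_cast at h ⊢; omega)
    have e2 := aN_symm n (k - 1) l (by push_cast at h ⊢; omega)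
    have hr : (k : ℝ) + l = n + 1 := by exact_mod_cast h
    rw [aN_succ (n + 1) k, aN_succ (n + 1) l, e1, e2]
    have : (k : ℝ) = n + 1 - l := by linarith
    rw [this]; push_cast; ring

lemma dN_two {n : ℕ} (H : ∀ k : ℤ, 2 * k ≤ n + 1 → dN n (k - 1) ≤ dN n k)
    (k : ℤ) (h : 2 * k ≤ n + 2) : dN n (k - 2) ≤ dN n k := by
  rcases eq_or_lt_of_le h with h | h
  · exact (dN_symm n _ _ (by omega)).le
  · have h1 := H k (by omega)
    have h2 := H (k - 1) (by omega)
    rw [show k - 1 - 1 = k - 2 by ring] at h2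
    exact h2.trans h1

lemma dN_uni : ∀ (n : ℕ) (k : ℤ), 2 * k ≤ n + 1 → dN n (k - 1) ≤ dN n k
  | 0, k, h => by
    rw [dN_neg 0 (k - 1) (by simp at h; omega)]
    simp only [dN]; split_ifs <;> norm_num
  | 1, k, h => by simp [dN]
  | (n + 2), k, h => by
    push_cast at h
    rcases lt_or_ge k 0 with hk | hk
    · rw [dN_neg _ k hk, dN_neg _ (k - 1) (by omega)]
    have h0 := dN_two (dN_uni (n + 1)) k (by push_cast; omega)
    have h1 := dN_uni (n + 1) (k - 1) (by push_cast; omega)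
    have h2 := dN_uni n (k - 1) (by omega)
    rw [show k - 1 - 1 = k - 2 by ring] at h1 h2
    rw [dN, dN]
    rw [show k - 1 - 1 = k - 2 by ring]
    have hk' : (0 : ℝ) ≤ k := by exact_mod_cast hk
    have hc : (0 : ℝ) ≤ n + 3 - 2 * k := by
      have : (2 * k : ℝ) ≤ n + 3 := by
        have : 2 * k ≤ (n : ℤ) + 3 := by omega
        exact_mod_cast this
      linarith
    have hn : (0 : ℝ) ≤ n + 1 := by positivity
    have a1 := mul_nonneg hk' (sub_nonneg.2 h0)
    have a2 := mul_nonneg hc (sub_nonneg.2 h1)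
    have a3 := mul_nonneg hn (sub_nonneg.2 h2)
    push_cast
    linarith

lemma aN_two {n : ℕ} (H : ∀ k : ℤ, 2 * k ≤ n → aN n (k - 1) ≤ aN n k)
    (k : ℤ) (h : 2 * k ≤ n + 1) : aN n (k - 2) ≤ aN n k := by
  rcases eq_or_lt_of_le h with h | h
  · cases n with
    | zero => simp at h; omega
    | succ n => exact (aN_symm n _ _ (by push_cast at h; omega)).le
  · have h1 := H k (by omega)
    have h2 := H (k - 1) (by omega)
    rw [show k - 1 - 1 = k - 2 by ring] at h2
    exact h2.trans h1

lemma aN_uni : ∀ (n : ℕ) (k : ℤ), 2 * k ≤ n → aN n (k - 1) ≤ aN n k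
  | 0, k, h => by
    rw [aN_neg 0 (k - 1) (by simp at h; omega)]
    simp only [aN]; split_ifs <;> norm_num
  | (n + 1), k, h => by
    push_cast at h
    rcases lt_or_ge k 0 with hk | hk
    · rw [aN_neg _ k hk, aN_neg _ (k - 1) (by omega)]
    have h0 := aN_two (aN_uni n) k (by omega)
    have h1 := aN_uni n (k - 1) (by omega)
    rw [show k - 1 - 1 = k - 2 by ring] at h1
    rw [aN, aN]
    rw [show k - 1 - 1 = k - 2 by ring]
    have hk' : (0 : ℝ) ≤ k + 1 := by exact_mod_cast (by omega : 0 ≤ k + 1)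
    have hc : (0 : ℝ) ≤ n + 1 - 2 * k := by
      have : (2 * k : ℝ) ≤ n + 1 := by exact_mod_cast h
      linarith
    have a1 := mul_nonneg hk' (sub_nonneg.2 h0)
    have a2 := mul_nonneg hc (sub_nonneg.2 h1)
    push_cast
    linarith

lemma u_rel (u : ℕ → ℤ → ℝ) (h0 : ∀ k, u 0 k = if k = 0 then 1 else 0)
    (h1 : ∀ k, u 1 k = if k = 0 then 1 else 0)
    (hr : ∀ n k, u (n + 2) k = (1 + k) * u (n + 1) k + (n + 2 - k) * u (n + 1) (k - 1)
      + (n + 1) * u n (k - 1)) :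
    ∀ n k, u n k = dN (n + 1) (k + 1) + dN n k
  | 0, k => by simp [h0, dN]
  | 1, k => by
    rw [h1]; simp [dN]
  | (n + 2), k => by
    rw [hr, u_rel u h0 h1 hr (n + 1) k, u_rel u h0 h1 hr (n + 1) (k - 1),
      u_rel u h0 h1 hr n (k - 1)]
    have e1 : dN (n + 2 + 1) (k + 1) = _ := dN_succ (n + 1) (k + 1)
    have e2 : dN (n + 2) k = _ := dN_succ n k
    rw [e1, e2]
    rw [show k + 1 - 1 = k by ring, show k - 1 + 1 = k by ring]
    push_cast
    ring

lemma c_rel (c : ℕ → ℤ → ℝ) (h0 : ∀ k, c 0 k = if k = 0 then 1 else 0)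
    (hr : ∀ n k, c (n + 1) k = (2 + k) * c n k + (n + 1 - k) * c n (k - 1)) :
    ∀ n k, c n k = aN (n + 1) (k + 1) - aN n (k + 1) + aN n k
  | 0, k => by
    rw [h0]; simp only [aN]
    by_cases h : k = 0
    · simp [h]
    by_cases h' : k + 1 = 0
    · have : k = -1 := by omega
      simp [this]
    simp [h, h']
  | (n + 1), k => by
    rw [hr, c_rel c h0 hr n k, c_rel c h0 hr n (k - 1)]
    rw [show k - 1 + 1 = k by ring, aN_succ (n + 1) (k + 1), show k + 1 - 1 = k by ring]
    rw [aN_succ n (k + 1), aN_succ n k, show k + 1 - 1 = k by ring]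
    push_cast
    ring

lemma u_ineq1 (n : ℕ) (k l : ℤ) (h : k + l = n - 1) (hk : 2 * k ≤ n - 1) :
    dN (n + 1) (k + 1) + dN n k ≤ dN (n + 1) (l + 1) + dN n l := by
  have e1 := dN_symm (n + 1) (k + 1) (l + 1) (by push_cast; omega)
  have e2 := dN_symm n l (k + 1) (by omega)
  have := dN_uni n (k + 1) (by omega)
  rw [show k + 1 - 1 = k by ring] at this
  linarith

lemma u_ineq2 (n : ℕ) (k l : ℤ) (h : k + l = n - 1) (hk : 2 * k + 1 ≤ n - 1) :
    dN (n + 1) (l + 1) + dN n l ≤ dN (n + 1) (k + 1 + 1) + dN n (k + 1) := by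
  have e1 := dN_symm (n + 1) (k + 1) (l + 1) (by push_cast; omega)
  have e2 := dN_symm n l (k + 1) (by omega)
  have := dN_uni (n + 1) (k + 1 + 1) (by push_cast; omega)
  rw [show k + 1 + 1 - 1 = k + 1 by ring] at this
  linarith

lemma c_ineq1 (n : ℕ) (k l : ℤ) (h : k + l = n) (h0 : 0 ≤ k) (hk : 2 * k ≤ n) :
    aN (n + 1 + 1) (l + 1) - aN (n + 1) (l + 1) + aN (n + 1) l ≤
    aN (n + 1 + 1) (k + 1) - aN (n + 1) (k + 1) + aN (n + 1) k := by
  have e1 := aN_symm (n + 1) k (l + 1) (by push_cast; omega)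
  have e2 := aN_symm n l k (by omega)
  have e3 := aN_symm n (l + 1) (k - 1) (by omega)
  have i1 := aN_uni (n + 1) k (by push_cast; omega)
  have i2 := aN_two (aN_uni (n + 1)) (k + 1) (by push_cast; omega)
  rw [show k + 1 - 2 = k - 1 by ring] at i2
  rw [← e1, e2, e3]
  rw [aN_succ (n + 1) (k + 1), aN_succ (n + 1) k, show k + 1 - 1 = k by ring]
  have hk' : (0 : ℝ) ≤ k + 1 := by exact_mod_cast (by omega : 0 ≤ k + 1)
  have hc : (0 : ℝ) ≤ n - 2 * k := by
    have : (2 * k : ℝ) ≤ n := by exact_mod_cast hk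
    linarith
  have a1 := mul_nonneg hk' (sub_nonneg.2 i2)
  have a2 := mul_nonneg hc (sub_nonneg.2 i1)
  push_cast
  linarith

lemma c_ineq2 (n : ℕ) (k l : ℤ) (h : k + l = n - 1) (hk : 2 * k + 1 ≤ n) :
    aN (n + 1 + 1) (k + 1) - aN (n + 1) (k + 1) + aN (n + 1) k ≤
    aN (n + 1 + 1) (l + 1) - aN (n + 1) (l + 1) + aN (n + 1) l := by
  have e1 := aN_symm (n + 1) (k + 1) (l + 1) (by push_cast; omega)
  have e2 := aN_symm n l (k + 1) (by omega)
  have e3 := aN_symm n (l + 1) k (by omega)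
  have i1 := aN_uni (n + 1) (k + 1) (by push_cast; omega)
  rw [show k + 1 - 1 = k by ring] at i1
  linarith

section PermPart
open Equiv Equiv.Perm

lemma card_ct_swap_fixed {α : Type*} [Fintype α] [DecidableEq α] (f : Perm α) (a p : α)
    (hap : a ≠ p) (ha : f a = a) (hp : f p = p) :
    (swap a p * f).cycleType.card = f.cycleType.card + 1 := by
  have hd : Perm.Disjoint (swap a p) f := by
    intro x
    by_cases h1 : x = a
    · right; rw [h1, ha]
    by_cases h2 : x = p
    · right; rw [h2, hp]
    left; exact swap_apply_of_ne_of_ne h1 h2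
  rw [hd.cycleType_mul, Multiset.card_add, card_cycleType_eq_one.2 (isCycle_swap hap), add_comm]

lemma card_ct_swap {α : Type*} [Fintype α] [DecidableEq α] (f : Perm α) (a p : α)
    (ha : f a = a) (hp : f p ≠ p) :
    (swap a p * f).cycleType.card = f.cycleType.card := by
  have hps : p ∈ f.support := mem_support.2 hp
  have hap : a ≠ p := by rintro rfl; exact hp ha
  set c := f.cycleOf p with hc
  have hcm : c ∈ f.cycleFactorsFinset := cycleOf_mem_cycleFactorsFinset_iff.2 hps
  have hd := (disjoint_mul_inv_of_mem_cycleFactorsFinset hcm)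
  have hcyc : c.IsCycle := isCycle_cycleOf f hp
  have hca : c a = a := by
    have := mem_cycleFactorsFinset_support_le hcm
    by_contra h
    exact (mem_support.1 (this (mem_support.2 h))) ha
  have hra : (f * c⁻¹) a = a := by
    rw [Perm.mul_apply, Perm.inv_eq_iff_eq.2 hca.symm, ha]
  have hrp : (f * c⁻¹) p = p := by
    rcases hd p with h | h
    · exact h
    · exfalso; rw [hc, cycleOf_apply_self] at h; exact hp h
  have hcyc' : (swap a p * c).IsCycle := by
    have hform := formPerm_toList f p
    rw [← hc] at hform
    have hlen : 2 ≤ (toList f p).length := two_le_length_toList_iff_mem_support.2 hps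
    have hnd := nodup_toList f p
    have h0 := toList_getElem_zero f p hps
    have hanot : a ∉ toList f p := by
      rw [mem_toList_iff]
      rintro ⟨h, -⟩
      exact hap (h.symm.eq_of_left ha)
    revert hform hlen hnd h0 hanot
    have gen : ∀ L : List α, L.formPerm = c → (hl : 2 ≤ L.length) → L.Nodup →
        L[0]'(by omega) = p → a ∉ L → (swap a p * c).IsCycle := by
      intro L hform hlen hnd h0 hanot
      match L, hlen with
      | x :: y :: l, _ =>
        have h0' : x = p := by simpa using h0
        rw [← h0', ← hform, ← List.formPerm_cons_cons]
        exact List.isCycle_formPerm (List.nodup_cons.2 ⟨hanot, hnd⟩) (by simp)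
    intro hform hlen hnd h0 hanot
    exact gen _ hform hlen hnd h0 hanot
  have hd' : Perm.Disjoint (swap a p * c) (f * c⁻¹) := by
    intro x
    by_cases h1 : x = a
    · right; rw [h1, hra]
    rcases hd x with h | h
    · right; exact h
    · left
      rw [Perm.mul_apply, h]
      refine swap_apply_of_ne_of_ne h1 ?_
      rintro rfl
      rw [hc, cycleOf_apply_self] at h; exact hp h
  have e1 : swap a p * f = (swap a p * c) * (f * c⁻¹) := by
    rw [mul_assoc, ← hd.commute.eq]; simp
  have e2 : f = (f * c⁻¹) * c := by simp
  rw [e1, hd'.cycleType_mul, Multiset.card_add, card_cycleType_eq_one.2 hcyc']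
  conv_rhs => rw [e2, hd.cycleType_mul, Multiset.card_add, card_cycleType_eq_one.2 hcyc]
  ring

/-- insert a fixed point at position `j` -/
def ext {n : ℕ} (j : Fin (n + 1)) (e : Perm (Fin n)) : Perm (Fin (n + 1)) :=
  e.extendDomain (finSuccAboveEquiv j)

lemma ext_self {n : ℕ} (j : Fin (n + 1)) (e : Perm (Fin n)) : ext j e j = j :=
  extendDomain_apply_not_subtype _ _ (by simp)

lemma ext_succAbove {n : ℕ} (j : Fin (n + 1)) (e : Perm (Fin n)) (i : Fin n) :
    ext j e (j.succAbove i) = j.succAbove (e i) := by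
  exact extendDomain_apply_image e (finSuccAboveEquiv j) i

lemma ext_ct {n : ℕ} (j : Fin (n + 1)) (e : Perm (Fin n)) :
    (ext j e).cycleType = e.cycleType := cycleType_extendDomain _

lemma ext_exc {n : ℕ} (j : Fin (n + 1)) (e : Perm (Fin n)) : excStat (ext j e) = excStat e := by
  simp only [excStat, card_filter]
  rw [Fin.sum_univ_succAbove _ j]
  simp [ext_self, ext_succAbove, (Fin.strictMono_succAbove j).lt_iff_lt]

lemma ext_fix {n : ℕ} (j : Fin (n + 1)) (e : Perm (Fin n)) : fixStat (ext j e) = fixStat e + 1 := by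
  simp only [fixStat, card_filter]
  rw [Fin.sum_univ_succAbove _ j]
  simp [ext_self, ext_succAbove, add_comm]

lemma ext_inj {n : ℕ} (j : Fin (n + 1)) : Function.Injective (ext (n := n) j) := by
  intro e e' h
  ext1 i
  have := congrArg (fun f => f (j.succAbove i)) h
  simpa [ext_succAbove] using this

lemma ext_surj {n : ℕ} (j : Fin (n + 1)) (f : Perm (Fin (n + 1))) (hf : f j = j) :
    ∃ e, ext j e = f := by
  refine ⟨(finSuccAboveEquiv j).symm.permCongr (f.subtypePerm (p := fun x => x ≠ j) ?_), ?_⟩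
  · intro x
    rw [not_iff_not]
    constructor
    · intro h; rw [← hf] at h; exact f.injective h
    · rintro rfl; exact hf
  · ext1 x
    rcases Fin.eq_self_or_eq_succAbove j x with rfl | ⟨i, rfl⟩
    · rw [ext_self, hf]
    · rw [ext_succAbove]
      have key : ∀ y, j.succAbove ((finSuccAboveEquiv j).symm y) = y.1 := fun y => by
        exact congrArg Subtype.val (Equiv.apply_symm_apply (finSuccAboveEquiv j) y)
      simp [permCongr_apply, key]
      rfl

/-- weight -/
noncomputable def wt (y q : ℝ) {n : ℕ} (e : Perm (Fin n)) : ℝ :=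
  y ^ fixStat e * q ^ e.cycleType.card

/-- weighted excedance numbers -/
noncomputable def RN (y q : ℝ) (n : ℕ) (k : ℤ) : ℝ :=
  ∑ e : Perm (Fin n), if (excStat e : ℤ) = k then wt y q e else 0

/-- insertion of 0 right after `j` -/
def ins {n : ℕ} (e : Perm (Fin n)) (j : Fin n) : Perm (Fin (n + 1)) :=
  decomposeFin.symm ((e j).succ, e)

lemma ins_zero {n : ℕ} (e : Perm (Fin n)) (j : Fin n) : ins e j 0 = (e j).succ := by
  simp [ins]

lemma ins_self {n : ℕ} (e : Perm (Fin n)) (j : Fin n) : ins e j j.succ = 0 := by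
  simp [ins]

lemma ins_ne {n : ℕ} (e : Perm (Fin n)) (j i : Fin n) (h : i ≠ j) :
    ins e j i.succ = (e i).succ := by
  rw [ins, decomposeFin_symm_apply_succ, swap_apply_of_ne_of_ne (Fin.succ_ne_zero _)]
  simpa using h

lemma dec_zero {n : ℕ} (e : Perm (Fin n)) : decomposeFin.symm (0, e) = ext 0 e := by
  ext1 x
  refine Fin.cases ?_ (fun i => ?_) x
  · rw [ext_self]; simp
  · have := ext_succAbove 0 e i
    simp only [Fin.succAbove_zero] at this
    rw [this]; simp

lemma ins_eq {n : ℕ} (e : Perm (Fin n)) (j : Fin n) :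
    ins e j = swap 0 (e j).succ * ext 0 e := by
  ext1 x
  rw [← dec_zero, Perm.mul_apply]
  refine Fin.cases ?_ (fun i => ?_) x
  · simp [ins]
  · simp [ins]

lemma ins_exc {n : ℕ} (e : Perm (Fin n)) (j : Fin n) :
    (excStat (ins e j) : ℤ) = excStat e + if j < e j then 0 else 1 := by
  simp only [excStat, card_filter]
  push_cast
  rw [Fin.sum_univ_succ, ins_zero]
  have : ∀ i : Fin n, (if i.succ < ins e j i.succ then (1 : ℤ) else 0) =
      (if i < e i then 1 else 0) - if i = j then (if j < e j then 1 else 0) else 0 := by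
    intro i
    by_cases h : i = j
    · subst h; simp [ins_self]
    · simp [ins_ne e j i h, h]
  simp only [this, Finset.sum_sub_distrib, Finset.sum_ite_eq', Finset.mem_univ, if_true,
    Fin.succ_pos]
  split_ifs <;> ring

lemma ins_fix {n : ℕ} (e : Perm (Fin n)) (j : Fin n) :
    fixStat (ins e j) + (if e j = j then 1 else 0) = fixStat e := by
  zify
  simp only [fixStat, card_filter]
  push_cast
  rw [Fin.sum_univ_succ, ins_zero]
  have : ∀ i : Fin n, (if ins e j i.succ = i.succ then (1 : ℤ) else 0) =
      (if e i = i then 1 else 0) - if i = j then (if e j = j then 1 else 0) else 0 := by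
    intro i
    by_cases h : i = j
    · subst h; simp [ins_self, (Fin.succ_ne_zero _).symm]
    · simp [ins_ne e j i h, h]
  simp only [this, Finset.sum_sub_distrib, Finset.sum_ite_eq', Finset.mem_univ, if_true,
    Fin.succ_ne_zero]
  simp

lemma ins_ct {n : ℕ} (e : Perm (Fin n)) (j : Fin n) :
    (ins e j).cycleType.card = e.cycleType.card + if e j = j then 1 else 0 := by
  have hs : ext 0 e (e j).succ = (e (e j)).succ := by
    have := ext_succAbove 0 e (e j)
    simpa using this
  rw [ins_eq]
  split_ifs with h
  · rw [card_ct_swap_fixed _ _ _ (Fin.succ_ne_zero _).symm (ext_self 0 e) (by rw [hs, h, h]), ext_ct]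
  · rw [card_ct_swap _ _ _ (ext_self 0 e) (by rw [hs]; simpa using h), ext_ct, add_zero]

lemma ins_wt {y q : ℝ} (hy : y ≠ 0) {n : ℕ} (e : Perm (Fin n)) (j : Fin n) :
    wt y q (ins e j) = wt y q e + (q / y - 1) * if e j = j then wt y q e else 0 := by
  have h1 := ins_fix e j
  have h2 := ins_ct e j
  simp only [wt]
  rw [h2, ← h1]
  split_ifs
  · rw [pow_succ, pow_succ]; field_simp; ring
  · simp

lemma ext_wt {y q : ℝ} {n : ℕ} (j : Fin (n + 1)) (e : Perm (Fin n)) :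
    wt y q (ext j e) = y * wt y q e := by
  simp only [wt, ext_ct, ext_fix, pow_succ]; ring

lemma sum_fixed (y q : ℝ) (n : ℕ) (k : ℤ) (j : Fin (n + 1)) :
    ∑ e : Perm (Fin (n + 1)), (if (excStat e : ℤ) = k then (if e j = j then wt y q e else 0) else 0)
      = y * RN y q n k := by
  rw [RN, Finset.mul_sum]
  have : ∀ e : Perm (Fin n), y * (if (excStat e : ℤ) = k then wt y q e else 0) =
      (if (excStat (ext j e) : ℤ) = k then
        (if ext j e j = j then wt y q (ext j e) else 0) else 0) := by
    intro e
    rw [ext_exc, ext_wt, if_pos (ext_self j e), mul_ite, mul_zero]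
  simp only [this]
  symm
  rw [← Finset.sum_image (s := Finset.univ) (g := ext j)
    (f := fun f => if (excStat f : ℤ) = k then (if f j = j then wt y q f else 0) else 0)
    (fun a _ b _ h => ext_inj j h)]
  apply Finset.sum_subset (Finset.subset_univ _)
  intro f _ hf
  have : f j ≠ j := by
    intro h
    obtain ⟨e, rfl⟩ := ext_surj j f h
    exact hf (Finset.mem_image_of_mem _ (Finset.mem_univ _))
  simp [this]

lemma RN_step {y q : ℝ} (hy : y ≠ 0) (n : ℕ) (k : ℤ) :
    RN y q (n + 1) k = (y + k) * RN y q n k + (n + 1 - k) * RN y q n (k - 1)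
      + (q / y - 1) * ∑ j : Fin n, ∑ e : Perm (Fin n),
        (if (excStat e : ℤ) = k - 1 then (if e j = j then wt y q e else 0) else 0) := by
  have h1 : RN y q (n + 1) k = ∑ e : Perm (Fin n),
      ((if (excStat (ext 0 e) : ℤ) = k then wt y q (ext 0 e) else 0) +
        ∑ j, if (excStat (ins e j) : ℤ) = k then wt y q (ins e j) else 0) := by
    rw [RN, ← Equiv.sum_comp decomposeFin.symm, Fintype.sum_prod_type, Finset.sum_comm]
    refine Finset.sum_congr rfl fun e _ => ?_
    rw [Fin.sum_univ_succ, dec_zero]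
    congr 1
    rw [← Equiv.sum_comp e]
    rfl
  rw [h1, Finset.sum_comm (s := (Finset.univ : Finset (Fin n)))]
  simp only [RN, Finset.mul_sum, ← Finset.sum_add_distrib]
  refine Finset.sum_congr rfl fun e _ => ?_
  rw [ext_exc, ext_wt]
  have h2 : ∀ j, (if (excStat (ins e j) : ℤ) = k then wt y q (ins e j) else 0) =
      (if (excStat e : ℤ) = k then wt y q e else 0) * (if j < e j then 1 else 0) +
      (if (excStat e : ℤ) = k - 1 then wt y q e else 0) * (1 - if j < e j then 1 else 0) +
      (q / y - 1) * (if (excStat e : ℤ) = k - 1 then (if e j = j then wt y q e else 0) else 0) := by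
    intro j
    rw [ins_exc, ins_wt hy]
    by_cases hj : j < e j
    · have hj' : e j ≠ j := hj.ne'
      simp [hj, hj']
    · have : ((excStat e : ℤ) + 1 = k) ↔ ((excStat e : ℤ) = k - 1) := by omega
      simp only [hj, if_false, this]
      split_ifs <;> ring
  simp only [h2, Finset.sum_add_distrib, ← Finset.mul_sum, Finset.sum_sub_distrib]
  have h3 : ∑ j : Fin n, (if j < e j then (1 : ℝ) else 0) = excStat e := by
    simp [excStat]
  rw [h3]
  simp only [Finset.sum_const, Finset.card_univ, Fintype.card_fin, nsmul_eq_mul, mul_one]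
  by_cases ha : (excStat e : ℤ) = k
  · have hb : ¬ ((excStat e : ℤ) = k - 1) := by omega
    have hr : (excStat e : ℝ) = k := by exact_mod_cast ha
    simp only [if_pos ha, if_neg hb, hr]; simp; ring
  · by_cases hb : (excStat e : ℤ) = k - 1
    · have hr : (excStat e : ℝ) = k - 1 := by exact_mod_cast hb
      simp only [if_neg ha, if_pos hb, hr]; ring
    · simp only [if_neg ha, if_neg hb]; simp

lemma RN_rec {y q : ℝ} (hy : y ≠ 0) (n : ℕ) (k : ℤ) :
    RN y q (n + 2) k = (y + k) * RN y q (n + 1) k + (n + 2 - k) * RN y q (n + 1) (k - 1)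
      + (q - y) * (n + 1) * RN y q n (k - 1) := by
  rw [RN_step hy (n + 1) k]
  simp only [sum_fixed, Finset.sum_const, Finset.card_univ, Fintype.card_fin, nsmul_eq_mul]
  push_cast
  field_simp
  ring

lemma RN_zero (y q : ℝ) (k : ℤ) : RN y q 0 k = if k = 0 then 1 else 0 := by
  simp [RN, wt, excStat, fixStat, eq_comm]

lemma exc_lt {n : ℕ} (hn : 1 ≤ n) (e : Perm (Fin n)) : excStat e < n := by
  obtain ⟨m, rfl⟩ : ∃ m, n = m + 1 := ⟨n - 1, by omega⟩
  have : excStat e < (Finset.univ : Finset (Fin (m + 1))).card := by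
    apply Finset.card_lt_card
    rw [Finset.filter_ssubset]
    exact ⟨Fin.last m, Finset.mem_univ _, not_lt.2 (Fin.le_last _)⟩
  simpa using this

lemma uCoeff_eq (n k : ℕ) : uCoeff n k = RN 1 2 n k := by
  simp [uCoeff, RN, wt, cyc, Finset.sum_filter]

lemma cCoeff_eq (n k : ℕ) : cCoeff n k = RN 2 2 n k := by
  simp [cCoeff, RN, wt, cyc, Finset.sum_filter, pow_add, mul_comm]

lemma u_final (n : ℕ) (k : ℕ) : uCoeff n k = dN (n + 1) (k + 1) + dN n k := by
  rw [uCoeff_eq]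
  refine u_rel (RN 1 2) (RN_zero _ _) ?_ ?_ n k
  · intro k
    have h1 := RN_step (q := 2) (one_ne_zero (α := ℝ)) 0 k
    rw [zero_add] at h1
    rw [h1, RN_zero, RN_zero]
    by_cases h : k = 0
    · simp [h]
    by_cases h' : k = 1
    · simp [h']
    have : ¬ (k - 1 = 0) := by omega
    simp [h, this]
  · intro n k
    rw [RN_rec one_ne_zero]
    norm_num

lemma c_final (n : ℕ) (k : ℕ) : cCoeff n k = aN (n + 1) (k + 1) - aN n (k + 1) + aN n k := by
  rw [cCoeff_eq]
  refine c_rel (RN 2 2) (RN_zero _ _) ?_ n k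
  intro n k
  rw [RN_step two_ne_zero]
  norm_num

lemma poly_eq {n : ℕ} (hn : 1 ≤ n) (x : ℝ) (w : Perm (Fin n) → ℝ) :
    ∑ σ, x ^ excStat σ * w σ =
      ∑ k ∈ Finset.range n, (∑ σ ∈ Finset.univ.filter fun σ : Perm (Fin n) => excStat σ = k, w σ)
        * x ^ k := by
  rw [← Finset.sum_fiberwise_of_maps_to (s := Finset.univ) (t := Finset.range n)
    (g := fun σ : Perm (Fin n) => excStat σ) (fun σ _ => Finset.mem_range.2 (exc_lt hn σ))]
  refine Finset.sum_congr rfl fun k _ => ?_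
  rw [Finset.sum_mul]
  refine Finset.sum_congr rfl fun σ h => ?_
  rw [(Finset.mem_filter.1 h).2, mul_comm]

end PermPart

/-- for `n ≥ 2`, (a) the coefficients of
`Σ_{σ ∈ S_n} x^exc 2^(cyc-fix)` are alternatingly increasing:
`u_0 ≤ u_{n-1} ≤ u_1 ≤ u_{n-2} ≤ ⋯ ≤ u_{⌊n/2⌋}`; and (b) the coefficients of
`Σ_{σ ∈ S_n} x^exc 2^cyc` are spiral: `c_{n-1} ≤ c_0 ≤ c_{n-2} ≤ c_1 ≤ ⋯ ≤ c_{⌊(n-1)/2⌋}`. -/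
theorem statement15 (n : ℕ) (hn : 2 ≤ n) :
    ((∀ x : ℝ,
        ∑ σ : Equiv.Perm (Fin n), x ^ excStat σ * (2 : ℝ) ^ (cyc σ - fixStat σ) =
          ∑ k ∈ Finset.range n, uCoeff n k * x ^ k) ∧
      (∀ k, 2 * k ≤ n - 1 → uCoeff n k ≤ uCoeff n (n - 1 - k)) ∧
      (∀ k, 2 * k + 1 ≤ n - 1 → uCoeff n (n - 1 - k) ≤ uCoeff n (k + 1))) ∧
    ((∀ x : ℝ,
        ∑ σ : Equiv.Perm (Fin n), x ^ excStat σ * (2 : ℝ) ^ cyc σ =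
          ∑ k ∈ Finset.range n, cCoeff n k * x ^ k) ∧
      (∀ k, 2 * k ≤ n - 1 → cCoeff n (n - 1 - k) ≤ cCoeff n k) ∧
      (∀ k, 2 * k + 1 ≤ n - 1 → cCoeff n k ≤ cCoeff n (n - 2 - k))) := by
  refine ⟨⟨fun x => poly_eq (by omega) x _, fun k hk => ?_, fun k hk => ?_⟩,
    fun x => poly_eq (by omega) x _, fun k hk => ?_, fun k hk => ?_⟩
  · rw [u_final, u_final]
    exact u_ineq1 n _ _ (by omega) (by omega)
  · rw [u_final, u_final]
    push_cast
    exact u_ineq2 n _ _ (by omega) (by omega)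
  · obtain ⟨m, rfl⟩ : ∃ m, n = m + 1 := ⟨n - 1, by omega⟩
    rw [c_final, c_final]
    exact c_ineq1 m _ _ (by omega) (by omega) (by omega)
  · obtain ⟨m, rfl⟩ : ∃ m, n = m + 1 := ⟨n - 1, by omega⟩
    rw [c_final, c_final]
    exact c_ineq2 m _ _ (by omega) (by omega)

end SucEuler
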